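/- arXiv:2203.02862 — 2 statements merged into one kernel-verified Lean document; each statement's English description precedes it below -/
import Mathlib

section
/- Let n ≥ 3 be an integer. Then the polynomial ρ = x_{n−1} x_{n−3} − ((n−1)/(n−2))·x_{n−2}^2 belongs to S_{n,2}, but ρ does not belong to S_{n−1,2} (indeed ρ involves the variable x_{n−1}, so it is not a polynomial in x_0, …, x_{n−2}). -/
open MvPolynomial

/-- The jet inversion: given the jets `a j = x^{(j)}(t₀)` of a function `x` with
`x(t₀) ≠ 0`, `iota a j = (1/x)^{(j)}(t₀)`, defined by `iota a 0 = 1 / a 0` and the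
recursion `∑_{j=0}^{k} (k.choose j) * a j * iota a (k - j) = 0` for `k ≥ 1`. -/
noncomputable def iota (a : ℕ → ℂ) : ℕ → ℂ
  | 0 => 1 / a 0
  | (k+1) => -(1 / a 0) * ∑ j ∈ Finset.range (k+1),
      ((k+1).choose (j+1) : ℂ) * a (j+1) * iota a (k - j)
  termination_by k => k
  decreasing_by exact Nat.lt_succ_of_le (Nat.sub_le k j)

/-- `JetRel n ρ₁ ρ₂` means `ρ₁ ∼ₙ ρ₂`:  `ρ₁(a) = a₀ⁿ ρ₂(ιₙ(a))` whenever `a₀ ≠ 0`. -/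
def JetRel (n : ℕ) (ρ₁ ρ₂ : MvPolynomial ℕ ℂ) : Prop :=
  ∀ a : ℕ → ℂ, a 0 ≠ 0 → eval a ρ₁ = (a 0) ^ n * eval (iota a) ρ₂

/-- The space `Sₙ` of polynomials `ρ₁ ∈ ℂ[x₀, …, x_{n-1}]` such that `ρ₁ ∼ₙ ρ₂` for some
polynomial `ρ₂ ∈ ℂ[x₀, …, x_{n-1}]`. -/
noncomputable def Sn (n : ℕ) : Submodule ℂ (MvPolynomial ℕ ℂ) where
  carrier := {ρ₁ | ρ₁ ∈ supported ℂ (Set.Iio n) ∧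
    ∃ ρ₂ ∈ supported ℂ (Set.Iio n), JetRel n ρ₁ ρ₂}
  add_mem' := by
    rintro p q ⟨hp, p₂, hp₂, hrp⟩ ⟨hq, q₂, hq₂, hrq⟩
    refine ⟨add_mem hp hq, p₂ + q₂, add_mem hp₂ hq₂, fun a ha => ?_⟩
    simp only [map_add, hrp a ha, hrq a ha, mul_add]
  zero_mem' := ⟨zero_mem _, 0, zero_mem _, fun a ha => by simp⟩
  smul_mem' := by
    rintro c p ⟨hp, p₂, hp₂, hrp⟩
    refine ⟨Subalgebra.smul_mem _ hp c, c • p₂, Subalgebra.smul_mem _ hp₂ c, fun a ha => ?_⟩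
    simp only [MvPolynomial.smul_eq_C_mul, map_mul, eval_C, hrp a ha]
    ring

/-- `S_{n,d}`: the homogeneous degree-`d` part of `Sₙ`. -/
noncomputable def Snd (n d : ℕ) : Submodule ℂ (MvPolynomial ℕ ℂ) :=
  Sn n ⊓ homogeneousSubmodule ℕ ℂ d

/-- `S_{n,d,l}`: the part of `S_{n,d}` of weighted degree `l`, where variable `xᵢ`
has weight `i`. -/
noncomputable def Sndl (n d l : ℕ) : Submodule ℂ (MvPolynomial ℕ ℂ) :=
  Snd n d ⊓ weightedHomogeneousSubmodule ℂ (fun i : ℕ => i) l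

/-- The `k`-th Taylor coefficient of a function with jet `a`. -/
noncomputable def taylorCoeff (a : ℕ → ℂ) (k : ℕ) : ℂ := a k / (k.factorial : ℂ)

/-- The Taylor coefficients shifted by one index. -/
noncomputable def shiftedTaylorCoeff (a : ℕ → ℂ) : ℕ → ℂ
  | 0 => 0
  | k + 1 => taylorCoeff a k

/-- The `2 × 2` minor of the Toeplitz matrix of Taylor coefficients on rows `k` and `l`. -/
noncomputable def toeplitzMinor (a : ℕ → ℂ) (k l : ℕ) : ℂ :=
  taylorCoeff a k * shiftedTaylorCoeff a l - shiftedTaylorCoeff a k * taylorCoeff a l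

theorem iota_zero (a : ℕ → ℂ) : iota a 0 = 1 / a 0 := by
  rw [iota]

theorem taylorCoeff_iota_succ (a : ℕ → ℂ) (k : ℕ) :
    taylorCoeff (iota a) (k + 1) = -(1 / a 0) * ∑ j ∈ Finset.range (k + 1),
      taylorCoeff a (j + 1) * taylorCoeff (iota a) (k - j) := by
  simp only [taylorCoeff]
  rw [iota, mul_div_assoc, Finset.sum_div]
  congr 1
  refine Finset.sum_congr rfl fun j hj => ?_
  have hjk : j ≤ k := Nat.lt_succ_iff.mp (Finset.mem_range.mp hj)
  rw [Nat.cast_choose ℂ (Nat.succ_le_succ hjk), Nat.succ_sub_succ]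
  have h₁ : ((k + 1).factorial : ℂ) ≠ 0 := Nat.cast_ne_zero.mpr (Nat.factorial_ne_zero _)
  field_simp

theorem sum_taylorCoeff_mul_taylorCoeff_iota (a : ℕ → ℂ) (ha : a 0 ≠ 0) (k : ℕ) :
    ∑ j ∈ Finset.range (k + 2), taylorCoeff a j * taylorCoeff (iota a) (k + 1 - j) = 0 := by
  rw [Finset.sum_range_succ']
  simp only [Nat.add_sub_add_right, Nat.sub_zero]
  rw [taylorCoeff_iota_succ, show taylorCoeff a 0 = a 0 by simp [taylorCoeff]]
  field_simp
  ring

theorem taylorCoeff_succ (a : ℕ → ℂ) (ha : a 0 ≠ 0) (k : ℕ) :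
    taylorCoeff a (k + 1) = -a 0 * ∑ j ∈ Finset.range (k + 1),
      taylorCoeff (iota a) (j + 1) * taylorCoeff a (k - j) := by
  have h := sum_taylorCoeff_mul_taylorCoeff_iota a ha k
  rw [← Finset.sum_range_reflect, Finset.sum_range_succ'] at h
  have hs : ∑ j ∈ Finset.range (k + 1), taylorCoeff a (k + 2 - 1 - (j + 1)) *
      taylorCoeff (iota a) (k + 1 - (k + 2 - 1 - (j + 1))) =
      ∑ j ∈ Finset.range (k + 1), taylorCoeff (iota a) (j + 1) * taylorCoeff a (k - j) := by
    refine Finset.sum_congr rfl fun j hj => ?_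
    have hjk := Finset.mem_range.mp hj
    rw [mul_comm, show k + 2 - 1 - (j + 1) = k - j by omega,
      show k + 1 - (k - j) = j + 1 by omega]
  rw [hs] at h
  have h₀ : taylorCoeff (iota a) 0 = 1 / a 0 := by simp [taylorCoeff, iota_zero]
  simp only [Nat.sub_zero, show k + 2 - 1 = k + 1 from rfl,
    Nat.sub_self, h₀] at h
  field_simp at h
  linear_combination h

theorem shiftedTaylorCoeff_succ_succ (a : ℕ → ℂ) (ha : a 0 ≠ 0) (k : ℕ) :
    shiftedTaylorCoeff a (k + 2) = -a 0 * ∑ j ∈ Finset.range (k + 2),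
      taylorCoeff (iota a) (j + 1) * shiftedTaylorCoeff a (k + 1 - j) := by
  rw [Finset.sum_range_succ, Nat.sub_self]
  simp only [shiftedTaylorCoeff, mul_zero, add_zero]
  rw [taylorCoeff_succ a ha]
  congr 1
  refine Finset.sum_congr rfl fun j hj => ?_
  rw [Nat.succ_sub (Nat.lt_succ_iff.mp (Finset.mem_range.mp hj))]

theorem toeplitzMinor_self (a : ℕ → ℂ) (k : ℕ) : toeplitzMinor a k k = 0 := by
  rw [toeplitzMinor]; ring

theorem toeplitzMinor_swap (a : ℕ → ℂ) (k l : ℕ) :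
    toeplitzMinor a k l = -toeplitzMinor a l k := by
  rw [toeplitzMinor, toeplitzMinor]; ring

theorem toeplitzMinor_succ_succ (a : ℕ → ℂ) (ha : a 0 ≠ 0) (k l : ℕ) :
    toeplitzMinor a (k + 2) l = -a 0 * ∑ j ∈ Finset.range (k + 2),
      taylorCoeff (iota a) (j + 1) * toeplitzMinor a (k + 1 - j) l := by
  rw [toeplitzMinor, taylorCoeff_succ a ha, shiftedTaylorCoeff_succ_succ a ha, mul_assoc,
    mul_assoc, ← mul_sub, Finset.sum_mul, Finset.sum_mul, ← Finset.sum_sub_distrib]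
  congr 1
  refine Finset.sum_congr rfl fun j _ => ?_
  rw [toeplitzMinor]; ring

/-- A Toeplitz minor on rows of index at most `K` is `a₀ ^ (K + 1)` times a polynomial in the
inverse jet of order `K`. -/
theorem exists_toeplitzMinor_eq (K : ℕ) : ∀ k ≤ K, ∀ l ≤ K,
    ∃ q ∈ supported ℂ (Set.Iio (K + 1)), ∀ a : ℕ → ℂ, a 0 ≠ 0 →
      toeplitzMinor a k l = a 0 ^ (K + 1) * eval (iota a) q := by
  induction K with
  | zero =>
    intro k hk l hl
    obtain rfl := Nat.le_zero.mp hk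
    obtain rfl := Nat.le_zero.mp hl
    exact ⟨0, zero_mem _, fun a _ => by simp [toeplitzMinor_self]⟩
  | succ K ih =>
    have hmono : supported ℂ (Set.Iio (K + 1)) ≤ supported ℂ (Set.Iio (K + 1 + 1)) :=
      supported_mono (Set.Iio_subset_Iio (Nat.le_succ _))
    have hX : ∀ i < K + 1 + 1, (X i : MvPolynomial ℕ ℂ) ∈ supported ℂ (Set.Iio (K + 1 + 1)) :=
      fun i hi => X_mem_supported.mpr hi
    have htop : ∀ l ≤ K, ∃ q ∈ supported ℂ (Set.Iio (K + 1 + 1)), ∀ a : ℕ → ℂ, a 0 ≠ 0 →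
        toeplitzMinor a (K + 1) l = a 0 ^ (K + 1 + 1) * eval (iota a) q := by
      intro l hl
      rcases K with _ | K
      · obtain rfl := Nat.le_zero.mp hl
        refine ⟨-1, neg_mem (one_mem _), fun a _ => ?_⟩
        simp [toeplitzMinor, taylorCoeff, shiftedTaylorCoeff]
        ring
      · have hrow : ∀ j, ∃ q ∈ supported ℂ (Set.Iio (K + 1 + 1)), ∀ a : ℕ → ℂ, a 0 ≠ 0 →
            toeplitzMinor a (K + 1 - j) l = a 0 ^ (K + 1 + 1) * eval (iota a) q :=
          fun j => ih _ (Nat.sub_le _ _) l hl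
        choose q hq hqe using hrow
        refine ⟨-∑ j ∈ Finset.range (K + 2),
          C (1 / ((j + 1).factorial : ℂ)) * X (j + 1) * q j, ?_, fun a ha => ?_⟩
        · refine neg_mem (sum_mem fun j hj => mul_mem (mul_mem ?_ (hX _ ?_)) (hmono (hq j)))
          · exact Subalgebra.algebraMap_mem _ _
          · have := Finset.mem_range.mp hj
            omega
        · rw [toeplitzMinor_succ_succ a ha, map_neg, map_sum, mul_neg, neg_mul, Finset.mul_sum,
            Finset.mul_sum]
          congr 1
          refine Finset.sum_congr rfl fun j _ => ?_
          rw [hqe j a ha, map_mul, map_mul, eval_C, eval_X, taylorCoeff]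
          ring
    intro k hk l hl
    rcases Nat.le_succ_iff.mp hk with hk | rfl <;> rcases Nat.le_succ_iff.mp hl with hl | rfl
    · obtain ⟨q, hq, hqe⟩ := ih k hk l hl
      refine ⟨X 0 * q, mul_mem (hX 0 (Nat.succ_pos _)) (hmono hq), fun a ha => ?_⟩
      rw [hqe a ha, map_mul, eval_X, iota_zero]
      field_simp
      ring
    · obtain ⟨q, hq, hqe⟩ := htop k hk
      refine ⟨-q, neg_mem hq, fun a ha => ?_⟩
      rw [toeplitzMinor_swap, hqe a ha, map_neg, mul_neg]
    · exact htop l hl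
    · exact ⟨0, zero_mem _, fun a _ => by simp [toeplitzMinor_self]⟩

/-- The value of a polynomial depends only on the values of its variables. -/
theorem eval_eq_of_mem_supported {σ R : Type*} [CommSemiring R] {s : Set σ}
    {p : MvPolynomial σ R} (hp : p ∈ supported R s) {x y : σ → R} (hxy : Set.EqOn x y s) :
    eval x p = eval y p := by
  rw [supported_eq_range_rename] at hp
  obtain ⟨q, rfl⟩ := hp
  have h : x ∘ ((↑) : s → σ) = y ∘ (↑) := funext fun i => hxy i.2
  simp only [RingHom.coe_coe, AlgHom.toRingHom_eq_coe, eval_rename, h]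

/-- **Proposition 5.1.** Let `n ≥ 3`. The polynomial
`ρ = x_{n−1} x_{n−3} − ((n−1)/(n−2)) x_{n−2}²` belongs to `S_{n,2}` but not to
`S_{n−1,2}` (as `ρ` involves the variable `x_{n−1}`). -/
theorem stmt6 (n : ℕ) (hn : 3 ≤ n) :
    (X (n - 1) * X (n - 3) - C (((n : ℂ) - 1) / ((n : ℂ) - 2)) * X (n - 2) ^ 2 ∈ Snd n 2) ∧
    (X (n - 1) * X (n - 3) - C (((n : ℂ) - 1) / ((n : ℂ) - 2)) * X (n - 2) ^ 2 ∉ Snd (n - 1) 2) := by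
  obtain ⟨m, rfl⟩ := Nat.exists_eq_add_of_le' hn
  rw [show m + 3 - 1 = m + 2 from rfl, show m + 3 - 2 = m + 1 from rfl,
    show m + 3 - 3 = m from rfl]
  have hm : (m : ℂ) + 1 ≠ 0 := Nat.cast_add_one_ne_zero m
  have hc : (((m + 3 : ℕ) : ℂ) - 1) / (((m + 3 : ℕ) : ℂ) - 2) = (m + 2) / (m + 1) := by
    push_cast
    congr 1 <;> ring
  rw [hc]
  refine ⟨⟨⟨?_, ?_⟩, ?_⟩, fun h => ?_⟩
  · have hX : ∀ i < m + 3, (X i : MvPolynomial ℕ ℂ) ∈ supported ℂ (Set.Iio (m + 3)) :=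
      fun i hi => X_mem_supported.mpr hi
    exact sub_mem (mul_mem (hX _ (by omega)) (hX _ (by omega)))
      (mul_mem (Subalgebra.algebraMap_mem _ _) (pow_mem (hX _ (by omega)) 2))
  · obtain ⟨q, hq, hqe⟩ := exists_toeplitzMinor_eq (m + 2) (m + 2) le_rfl (m + 1) (Nat.le_succ _)
    refine ⟨C (((m + 2).factorial : ℂ) * (m.factorial : ℂ)) * q,
      mul_mem (Subalgebra.algebraMap_mem _ _) hq, fun a ha => ?_⟩
    have h := hqe a ha
    rw [map_mul, eval_C, mul_left_comm, ← h]
    have hf : (m.factorial : ℂ) ≠ 0 := Nat.cast_ne_zero.mpr (Nat.factorial_ne_zero _)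
    have hm₂ : (m : ℂ) + 2 ≠ 0 := by exact_mod_cast Nat.succ_ne_zero (m + 1)
    have hm₂' : (m : ℂ) + 1 + 1 ≠ 0 := by exact_mod_cast Nat.succ_ne_zero (m + 1)
    simp only [toeplitzMinor, shiftedTaylorCoeff, taylorCoeff, map_sub, map_mul, map_pow, eval_X,
      eval_C, Nat.factorial_succ]
    push_cast
    field_simp
    ring
  · refine Submodule.sub_mem _ ?_ ?_
    · exact (isHomogeneous_X ℂ (m + 2)).mul (isHomogeneous_X ℂ m)
    · simpa using (isHomogeneous_C ℕ (((m : ℂ) + 2) / (m + 1))).mul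
        ((isHomogeneous_X ℂ (m + 1)).pow 2)
  · have h₁ := eval_eq_of_mem_supported h.1.1 (x := fun _ => 1)
      (y := Function.update (fun _ => 1) (m + 2) 0)
      fun i hi => (Function.update_of_ne (a := i) (ne_of_lt hi) 0 fun _ : ℕ => (1 : ℂ)).symm
    simp at h₁
end

section
/- Let d ≥ 1 and let k_1, …, k_d be nonnegative integers with K = k_1 + ⋯ + k_d. Then for every integer n ≥ 1 + max(k_1, …, k_d) (so that the monomial x_{k_1}⋯x_{k_d} is a polynomial in x_0, …, x_{n−1}), the monomial x_{k_1}⋯x_{k_d} belongs to S_n if and only if n ≥ K + d. In particular, x_{k_1}⋯x_{k_d} ∈ S_{K+d} \ S_{K+d−1}. -/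
open MvPolynomial

/-- `b` is the jet of the reciprocal of a function with jet `a`, by the Leibniz rule. -/
def IsJetInverse (a b : ℕ → ℂ) : Prop :=
  a 0 * b 0 = 1 ∧
    ∀ m, ∑ j ∈ Finset.range (m + 2), ((m + 1).choose j : ℂ) * a j * b (m + 1 - j) = 0

theorem IsJetInverse.symm {a b : ℕ → ℂ} (h : IsJetInverse a b) : IsJetInverse b a := by
  refine ⟨by rw [mul_comm, h.1], fun m => ?_⟩
  rw [← Finset.sum_range_reflect, ← h.2 m]
  refine Finset.sum_congr rfl fun j hj => ?_
  have hj' : j ≤ m + 1 := Nat.lt_succ_iff.mp (Finset.mem_range.mp hj)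
  rw [show m + 2 - 1 - j = m + 1 - j by omega, Nat.choose_symm hj',
    Nat.sub_sub_self hj']
  ring

theorem isJetInverse_iota {a : ℕ → ℂ} (ha : a 0 ≠ 0) : IsJetInverse a (iota a) := by
  refine ⟨by rw [iota, mul_one_div_cancel ha], fun m => ?_⟩
  rw [Finset.sum_range_succ', Nat.sub_zero, iota]
  simp only [Nat.add_sub_add_right, Nat.choose_zero_right, Nat.cast_one]
  field_simp
  ring

theorem IsJetInverse.eq_iota {a b : ℕ → ℂ} (h : IsJetInverse a b) : iota a = b := by
  have ha : a 0 ≠ 0 := left_ne_zero_of_mul_eq_one h.1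
  funext m
  induction m using Nat.strong_induction_on with
  | _ m ih =>
    cases m with
    | zero => rw [iota, one_div, inv_eq_of_mul_eq_one_right h.1]
    | succ m =>
      have hm := h.2 m
      rw [Finset.sum_range_succ', Nat.sub_zero] at hm
      simp only [Nat.add_sub_add_right, Nat.choose_zero_right, Nat.cast_one, one_mul] at hm
      rw [iota, Finset.sum_congr rfl fun j _ => by rw [ih (m - j) (by omega)],
        eq_neg_of_add_eq_zero_left hm]
      field_simp

theorem iota_iota {a : ℕ → ℂ} (ha : a 0 ≠ 0) : iota (iota a) = a :=
  (isJetInverse_iota ha).symm.eq_iota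

/-- The `k`-th entry of the jet inversion is a polynomial divided by `a 0 ^ (k + 1)`. -/
theorem exists_iota_numerator (k : ℕ) :
    ∃ P ∈ supported ℂ (Set.Iic k), ∀ a : ℕ → ℂ, a 0 ≠ 0 →
      eval a P = a 0 ^ (k + 1) * iota a k := by
  induction k using Nat.strong_induction_on with
  | _ k ih =>
    cases k with
    | zero => exact ⟨1, one_mem _, fun a ha => by simp [iota, ha]⟩
    | succ k =>
      choose! P hP hPeval using ih
      refine ⟨-∑ j ∈ Finset.range (k + 1),
        ((k + 1).choose (j + 1) : MvPolynomial ℕ ℂ) * X (j + 1) * X 0 ^ j * P (k - j),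
        neg_mem (sum_mem fun j hj => ?_), fun a ha => ?_⟩
      · have hj' := Finset.mem_range.mp hj
        refine mul_mem (mul_mem (mul_mem (natCast_mem _ _) ?_) (pow_mem ?_ _)) ?_
        · exact X_mem_supported.mpr (Set.mem_Iic.mpr (by omega))
        · exact X_mem_supported.mpr (Set.mem_Iic.mpr (by omega))
        · exact supported_mono (Set.Iic_subset_Iic.mpr (by omega)) (hP (k - j) (by omega))
      · rw [iota, ← mul_assoc, Finset.mul_sum]
        simp only [map_neg, map_sum, map_mul, map_pow, map_natCast, eval_X]
        rw [← Finset.sum_neg_distrib]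
        refine Finset.sum_congr rfl fun j hj => ?_
        have hj' := Finset.mem_range.mp hj
        rw [hPeval (k - j) (by omega) a ha,
          show a 0 ^ (k + 1 + 1) = a 0 * (a 0 ^ j * a 0 ^ (k - j + 1)) by
            rw [← pow_add, ← pow_succ']; congr 1; omega]
        field_simp

theorem monomial_mem_Sn {d : ℕ} (hd : 1 ≤ d) (k : Fin d → ℕ) {n : ℕ}
    (hk : ∀ i, k i + 1 ≤ n) (hn : ∑ i, k i + d ≤ n) :
    (∏ i, X (k i) : MvPolynomial ℕ ℂ) ∈ Sn n := by
  choose P hP hPeval using exists_iota_numerator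
  refine ⟨prod_mem fun i _ => X_mem_supported.mpr (hk i),
    X 0 ^ (n - (∑ i, k i + d)) * ∏ i, P (k i), mul_mem (pow_mem ?_ _)
      (prod_mem fun i _ => supported_mono (fun j hj => ?_) (hP (k i))), fun a ha => ?_⟩
  · exact X_mem_supported.mpr (Set.mem_Iio.mpr (by omega))
  · exact lt_of_le_of_lt (Set.mem_Iic.mp hj) (hk i)
  · have h0 : iota a 0 ≠ 0 := by rw [iota]; exact one_div_ne_zero ha
    simp only [map_mul, map_pow, map_prod, eval_X, hPeval _ _ h0, iota_iota ha]
    rw [Finset.prod_mul_distrib, Finset.prod_pow_eq_pow_sum, Finset.sum_add_distrib]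
    simp only [Finset.sum_const, Finset.card_univ, Fintype.card_fin, smul_eq_mul, mul_one]
    rw [← mul_assoc, ← mul_assoc, mul_assoc (a 0 ^ n), ← pow_add, Nat.sub_add_cancel hn,
      ← mul_pow, (isJetInverse_iota ha).1, one_pow, one_mul]

/-- The jet of `t ↦ s + t` at `0`. -/
def affineJet {R : Type*} [Semiring R] (s : R) (j : ℕ) : R :=
  if j = 0 then s else if j = 1 then 1 else 0

theorem isJetInverse_affineJet {s : ℂ} (hs : s ≠ 0) :
    IsJetInverse (affineJet s) (fun j => (-1) ^ j * j.factorial / s ^ (j + 1)) := by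
  refine ⟨by simp [affineJet, hs], fun m => ?_⟩
  rw [Finset.sum_range_succ', Finset.sum_range_succ']
  simp [affineJet, Nat.factorial_succ m]
  field_simp
  ring

theorem le_of_monomial_mem_Sn {d : ℕ} (k : Fin d → ℕ) {n : ℕ}
    (h : (∏ i, X (k i) : MvPolynomial ℕ ℂ) ∈ Sn n) : ∑ i, k i + d ≤ n := by
  obtain ⟨-, ρ, -, hρ⟩ := h
  let q : Polynomial ℂ := aeval (affineJet Polynomial.X) ρ
  let c : ℂ := ∏ i, (-1) ^ k i * ((k i).factorial : ℂ)
  have hc : c ≠ 0 := Finset.prod_ne_zero_iff.mpr fun i _ =>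
    mul_ne_zero (pow_ne_zero _ (by norm_num)) (Nat.cast_ne_zero.mpr (Nat.factorial_ne_zero _))
  have hq (s : ℂ) : q.eval s = eval (affineJet s) ρ := by
    have hjet : (fun j => (affineJet Polynomial.X j : Polynomial ℂ).eval s) = affineJet s := by
      funext j
      simp only [affineJet]
      split_ifs <;> simp
    rw [← hjet, ← Polynomial.coe_aeval_eq_eval, ← aeval_eq_eval]
    exact comp_aeval_apply (affineJet Polynomial.X) (Polynomial.aeval s) ρ
  have key : Polynomial.C c * Polynomial.X ^ n = Polynomial.X ^ (∑ i, k i + d) * q := by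
    refine Polynomial.eq_of_infinite_eval_eq _ _
      ((Set.finite_singleton (0 : ℂ)).infinite_compl.mono fun s hs => ?_)
    have hs : s ≠ 0 := hs
    have hinv := (isJetInverse_affineJet hs).symm
    have := hρ (fun j => (-1) ^ j * j.factorial / s ^ (j + 1))
      (left_ne_zero_of_mul_eq_one hinv.1)
    rw [hinv.eq_iota, ← hq] at this
    simp only [map_prod, eval_X, Finset.prod_div_distrib, Finset.prod_pow_eq_pow_sum,
      Finset.sum_add_distrib, Finset.sum_const, Finset.card_univ, Fintype.card_fin, smul_eq_mul,
      mul_one, pow_zero, Nat.factorial_zero, Nat.cast_one, zero_add, pow_one, one_div,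
      inv_pow] at this
    simp only [Set.mem_ofPred_eq, Polynomial.eval_mul, Polynomial.eval_C, Polynomial.eval_pow,
      Polynomial.eval_X]
    field_simp at this
    exact this
  have hdvd : (Polynomial.X : Polynomial ℂ) ^ (∑ i, k i + d) ∣ Polynomial.C c * Polynomial.X ^ n :=
    ⟨q, key⟩
  by_contra! hlt
  have := Polynomial.X_pow_dvd_iff.mp hdvd n hlt
  simp [hc] at this

/-- **Proposition 3.1 (second part).** Let `d ≥ 1` and `k₁, …, k_d ≥ 0` with
`K = k₁ + ⋯ + k_d`. For every `n ≥ 1 + max kᵢ`, the monomial `x_{k₁} ⋯ x_{k_d}` belongs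
to `Sₙ` iff `n ≥ K + d`. In particular `x_{k₁} ⋯ x_{k_d} ∈ S_{K+d} \ S_{K+d−1}`. -/
theorem stmt8 (d : ℕ) (hd : 1 ≤ d) (k : Fin d → ℕ) (K : ℕ) (hK : K = ∑ i, k i) :
    (∀ n : ℕ, (∀ i, k i + 1 ≤ n) →
      ((∏ i, X (k i) : MvPolynomial ℕ ℂ) ∈ Sn n ↔ K + d ≤ n)) ∧
    (∏ i, X (k i) : MvPolynomial ℕ ℂ) ∈ Sn (K + d) ∧
    (∏ i, X (k i) : MvPolynomial ℕ ℂ) ∉ Sn (K + d - 1) := by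
  subst hK
  refine ⟨fun n hn => ⟨le_of_monomial_mem_Sn k, monomial_mem_Sn hd k hn⟩,
    monomial_mem_Sn hd k (fun i => ?_) le_rfl, fun h => ?_⟩
  · have := Finset.single_le_sum (fun j _ => Nat.zero_le (k j)) (Finset.mem_univ i)
    omega
  · have := le_of_monomial_mem_Sn k h
    omega
end
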